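/- Let V be a nonempty finite type with distinguished element eos, M ≥ 0, and a : List V → V → ℝ with |a s v| ≤ M for all s, v. Define the sequence model p by p s v = exp(a s v) / ∑_{w ∈ V} exp(a s w). Then for every t ∈ ℕ, NT_p(t) ≤ (1 − exp(−2M)/|V|)^t, and NT_p(t) → 0 as t → ∞; that is, a language model whose per-step conditionals are softmaxes of uniformly bounded logits is consistent. -/

import Mathlib

open Finset Filter

/-- Non-termination mass of a sequence model `p` at horizon `t`. -/
noncomputable def NT {V : Type*} [Fintype V] [DecidableEq V]
    (p : List V → V → ℝ) (eos : V) (t : ℕ) : ℝ :=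
  ∑ y ∈ Finset.univ.filter (fun y : Fin t → V => ∀ i, y i ≠ eos),
    ∏ i : Fin t, p ((List.ofFn y).take i) (y i)

theorem NT_zero {V : Type*} [Fintype V] [DecidableEq V] (p : List V → V → ℝ) (eos : V) :
    NT p eos 0 = 1 := by
  simp [NT]

theorem NT_nonneg {V : Type*} [Fintype V] [DecidableEq V] {p : List V → V → ℝ}
    (hp : ∀ s v, 0 ≤ p s v) (eos : V) (t : ℕ) : 0 ≤ NT p eos t :=
  Finset.sum_nonneg fun _ _ => Finset.prod_nonneg fun _ _ => hp _ _

/-- Conditioning on the first token. -/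
theorem NT_succ {V : Type*} [Fintype V] [DecidableEq V] (p : List V → V → ℝ) (eos : V) (t : ℕ) :
    NT p eos (t + 1) =
      ∑ v ∈ Finset.univ.filter (· ≠ eos), p [] v * NT (fun s => p (v :: s)) eos t := by
  simp only [NT, Finset.sum_filter, Finset.mul_sum]
  rw [← (Fin.consEquiv fun _ : Fin (t + 1) => V).sum_comp, Fintype.sum_prod_type]
  refine Finset.sum_congr rfl fun v _ => ?_
  by_cases hv : v = eos
  · simp [Fin.consEquiv, Fin.forall_fin_succ, hv]
  · simp [Fin.consEquiv, Fin.forall_fin_succ, hv, Fin.prod_univ_succ, List.ofFn_succ]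

theorem NT_le_pow {V : Type*} [Fintype V] [DecidableEq V] (eos : V) {c : ℝ} (hc : 0 ≤ c)
    (t : ℕ) (p : List V → V → ℝ) (hp : ∀ s v, 0 ≤ p s v)
    (h : ∀ s, ∑ v ∈ Finset.univ.filter (· ≠ eos), p s v ≤ c) : NT p eos t ≤ c ^ t := by
  induction t generalizing p with
  | zero => simp [NT_zero]
  | succ t ih =>
    rw [NT_succ, pow_succ']
    calc ∑ v ∈ Finset.univ.filter (· ≠ eos), p [] v * NT (fun s => p (v :: s)) eos t
        ≤ ∑ v ∈ Finset.univ.filter (· ≠ eos), p [] v * c ^ t :=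
          Finset.sum_le_sum fun v _ => mul_le_mul_of_nonneg_left
            (ih _ (fun s => hp (v :: s)) fun s => h (v :: s)) (hp _ _)
      _ ≤ c * c ^ t := by
          rw [← Finset.sum_mul]
          exact mul_le_mul_of_nonneg_right (h []) (pow_nonneg hc t)

theorem exp_div_card_le_softmax {V : Type*} [Fintype V] [Nonempty V] {M : ℝ} {b : V → ℝ}
    (hb : ∀ v, |b v| ≤ M) (v : V) :
    Real.exp (-(2 * M)) / (Fintype.card V : ℝ) ≤ Real.exp (b v) / ∑ w, Real.exp (b w) := by
  have hcard : (0 : ℝ) < Fintype.card V := by exact_mod_cast Fintype.card_pos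
  have hpos : 0 < ∑ w, Real.exp (b w) :=
    Finset.sum_pos (fun _ _ => Real.exp_pos _) Finset.univ_nonempty
  have hsum : ∑ w, Real.exp (b w) ≤ Fintype.card V * Real.exp M := by
    simpa using Finset.sum_le_card_nsmul Finset.univ _ _
      fun w _ => Real.exp_le_exp.2 (abs_le.1 (hb w)).2
  rw [div_le_div_iff₀ hcard hpos]
  calc Real.exp (-(2 * M)) * ∑ w, Real.exp (b w)
      ≤ Real.exp (-(2 * M)) * (Fintype.card V * Real.exp M) := by gcongr
    _ = Real.exp (-M) * Fintype.card V := by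
        rw [mul_left_comm, ← Real.exp_add, mul_comm]
        ring_nf
    _ ≤ Real.exp (b v) * Fintype.card V := by
        gcongr
        exact (abs_le.1 (hb v)).1

/-- A language model whose per-step conditionals are softmaxes of uniformly bounded logits
is consistent: its non-termination mass satisfies `NT_p(t) ≤ (1 - exp(-2M)/|V|)^t → 0`. -/
theorem stmt_8 {V : Type*} [Fintype V] [DecidableEq V] [Nonempty V] (eos : V)
    (M : ℝ) (hM : 0 ≤ M)
    (a : List V → V → ℝ) (ha : ∀ s v, |a s v| ≤ M)
    (p : List V → V → ℝ)
    (hp : ∀ s v, p s v = Real.exp (a s v) / ∑ w, Real.exp (a s w)) :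
    (∀ t : ℕ, NT p eos t ≤ (1 - Real.exp (-(2 * M)) / (Fintype.card V : ℝ)) ^ t) ∧
      Tendsto (fun t => NT p eos t) atTop (nhds 0) := by
  set c : ℝ := Real.exp (-(2 * M)) / (Fintype.card V : ℝ) with hc
  have hcard : (1 : ℝ) ≤ Fintype.card V := by exact_mod_cast Fintype.card_pos
  have hc_pos : 0 < c := div_pos (Real.exp_pos _) (by linarith)
  have hc_le : c ≤ 1 :=
    div_le_one_of_le₀ ((Real.exp_le_one_iff.2 (by linarith)).trans hcard) (by linarith)
  have hp_nonneg : ∀ s v, 0 ≤ p s v := fun s v => by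
    rw [hp]
    positivity
  have hp_sum : ∀ s, ∑ v ∈ Finset.univ.filter (· ≠ eos), p s v ≤ 1 - c := fun s => by
    have htotal : ∑ v, p s v = 1 := by
      simp only [hp, ← Finset.sum_div]
      exact div_self (Finset.sum_pos (fun _ _ => Real.exp_pos _) Finset.univ_nonempty).ne'
    have heos : c ≤ p s eos := by
      rw [hp]
      exact exp_div_card_le_softmax (ha s) eos
    rw [Finset.filter_ne']
    linarith [Finset.add_sum_erase Finset.univ (p s) (Finset.mem_univ eos)]
  have hbound : ∀ t, NT p eos t ≤ (1 - c) ^ t := fun t =>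
    NT_le_pow eos (by linarith) t p hp_nonneg hp_sum
  exact ⟨hbound, squeeze_zero (NT_nonneg hp_nonneg eos) hbound
    (tendsto_pow_atTop_nhds_zero_of_lt_one (by linarith) (by linarith))⟩
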